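/- arXiv:2210.08128 — 10 statements merged into one kernel-verified Lean document; each statement's English description precedes it below -/
import Mathlib

section
/- Let L be a finite distributive lattice and let f, g be join-endomorphisms of L. Let h be the greatest join-endomorphism of L that lies pointwise below both f and g (such a greatest element exists). Then for every c ∈ L, h(c) = ⨅ { f(a) ⊔ g(b) : a, b ∈ L and a ⊔ b ≥ c }. -/
open scoped Classical

/-- A (bottom-preserving) join-endomorphism of a lattice with bottom. -/
def IsJoinEndo {L : Type*} [Lattice L] [OrderBot L] (f : L → L) : Prop :=
  f ⊥ = ⊥ ∧ ∀ a b : L, f (a ⊔ b) = f a ⊔ f b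

/-- A join-endomorphism is monotone. -/
theorem IsJoinEndo.monotone {L : Type*} [Lattice L] [OrderBot L] {f : L → L}
    (hf : IsJoinEndo f) : Monotone f := by
  intro a b hab
  rw [← sup_eq_right.mpr hab, hf.2]
  exact le_sup_left

/-- The meet of the values `f a ⊔ g b` over all pairs with `c ≤ a ⊔ b`. -/
noncomputable def coverInf {L : Type*} [Lattice L] [BoundedOrder L] [Fintype L]
    (f g : L → L) (c : L) : L :=
  (Finset.univ.filter (fun p : L × L => c ≤ p.1 ⊔ p.2)).inf (fun p => f p.1 ⊔ g p.2)

theorem coverInf_le {L : Type*} [Lattice L] [BoundedOrder L] [Fintype L]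
    (f g : L → L) {a b c : L} (h : c ≤ a ⊔ b) : coverInf f g c ≤ f a ⊔ g b :=
  Finset.inf_le (f := fun p : L × L => f p.1 ⊔ g p.2) (b := (a, b)) (by simpa using h)

theorem le_coverInf {L : Type*} [Lattice L] [BoundedOrder L] [Fintype L]
    {f g : L → L} {c x : L} (h : ∀ a b, c ≤ a ⊔ b → x ≤ f a ⊔ g b) : x ≤ coverInf f g c :=
  Finset.le_inf fun p hp => h p.1 p.2 (by simpa using hp)

theorem coverInf_le_left {L : Type*} [Lattice L] [BoundedOrder L] [Fintype L]
    {f g : L → L} (hg : IsJoinEndo g) (c : L) : coverInf f g c ≤ f c := by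
  simpa [hg.1] using coverInf_le f g (a := c) (b := ⊥) (c := c) le_sup_left

theorem coverInf_le_right {L : Type*} [Lattice L] [BoundedOrder L] [Fintype L]
    {f g : L → L} (hf : IsJoinEndo f) (c : L) : coverInf f g c ≤ g c := by
  simpa [hf.1] using coverInf_le f g (a := ⊥) (b := c) (c := c) le_sup_right

theorem coverInf_mono {L : Type*} [Lattice L] [BoundedOrder L] [Fintype L]
    (f g : L → L) : Monotone (coverInf f g) := fun _ _ hcd =>
  le_coverInf fun _ _ hab => coverInf_le f g (hcd.trans hab)

/-- In a distributive lattice, `coverInf f g` is itself a join-endomorphism. -/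
theorem isJoinEndo_coverInf {L : Type*} [DistribLattice L] [BoundedOrder L] [Fintype L]
    {f g : L → L} (hf : IsJoinEndo f) (hg : IsJoinEndo g) : IsJoinEndo (coverInf f g) := by
  refine ⟨le_bot_iff.mp ((coverInf_le_left hg ⊥).trans_eq hf.1), fun c d => le_antisymm ?_
    (sup_le (coverInf_mono f g le_sup_left) (coverInf_mono f g le_sup_right))⟩
  rw [coverInf, coverInf, coverInf, Finset.inf_sup_inf]
  refine Finset.le_inf fun p hp => ?_
  simp only [Finset.mem_product, Finset.mem_filter, Finset.mem_univ, true_and] at hp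
  rw [sup_sup_sup_comm, ← hf.2, ← hg.2]
  refine coverInf_le f g ?_
  rw [sup_sup_sup_comm]
  exact sup_le_sup hp.1 hp.2

theorem stmt_0 {L : Type*} [DistribLattice L] [BoundedOrder L] [Fintype L]
    (f g h : L → L) (hf : IsJoinEndo f) (hg : IsJoinEndo g) (hh : IsJoinEndo h)
    (hhf : ∀ a, h a ≤ f a) (hhg : ∀ a, h a ≤ g a)
    (hmax : ∀ k : L → L, IsJoinEndo k → (∀ a, k a ≤ f a) → (∀ a, k a ≤ g a) →
      ∀ a, k a ≤ h a) :
    ∀ c : L,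
      h c = (Finset.univ.filter (fun p : L × L => c ≤ p.1 ⊔ p.2)).inf
        (fun p => f p.1 ⊔ g p.2) := by
  intro c
  refine le_antisymm (le_coverInf fun a b hab => ?_)
    (hmax (coverInf f g) (isJoinEndo_coverInf hf hg) (coverInf_le_left hg)
      (coverInf_le_right hf) c)
  exact (hh.monotone hab).trans ((hh.2 a b).trans_le (sup_le_sup (hhf a) (hhg b)))
end

section
/- Let L be a finite distributive lattice and let f, g be join-endomorphisms of L. Let h be the greatest join-endomorphism of L that lies pointwise below both f and g. For a, c ∈ L define c ⊖ a := ⨅ { e ∈ L : a ⊔ e ≥ c }. Then for every c ∈ L, h(c) = ⨅ { f(a) ⊔ g(c ⊖ a) : a ∈ L, a ≤ c }. -/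
open scoped Classical

/-- The subtraction `c ⊖ a = ⨅ { e | a ⊔ e ≥ c }` in a finite lattice. -/
noncomputable def latSub {L : Type*} [Lattice L] [BoundedOrder L] [Fintype L]
    (c a : L) : L :=
  (Finset.univ.filter (fun e : L => c ≤ a ⊔ e)).inf id

theorem latSub_le {L : Type*} [Lattice L] [BoundedOrder L] [Fintype L] {a c e : L}
    (hc : c ≤ a ⊔ e) : latSub c a ≤ e :=
  Finset.inf_le (f := id) (by simpa using hc)

theorem le_sup_latSub {L : Type*} [DistribLattice L] [BoundedOrder L] [Fintype L] (c a : L) :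
    c ≤ a ⊔ latSub c a := by
  rw [latSub, Finset.inf_sup_distrib_left]
  exact Finset.le_inf fun e he => by simpa using he

/-- The candidate meet `c ↦ ⨅ { f a ⊔ g (c ⊖ a) | a ≤ c }` of two join-endomorphisms. -/
noncomputable def infSub {L : Type*} [Lattice L] [BoundedOrder L] [Fintype L]
    (f g : L → L) (c : L) : L :=
  (Finset.univ.filter (fun a : L => a ≤ c)).inf (fun a => f a ⊔ g (latSub c a))

section infSub

variable {L : Type*} [DistribLattice L] [BoundedOrder L] [Fintype L] {f g : L → L}

theorem infSub_le_sup (hf : Monotone f) (hg : Monotone g) {a b c : L} (hc : c ≤ a ⊔ b) :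
    infSub f g c ≤ f a ⊔ g b := by
  have hsub : latSub c (a ⊓ c) ≤ b := latSub_le <| by
    rw [sup_inf_right]
    exact le_inf hc le_sup_left
  calc infSub f g c ≤ f (a ⊓ c) ⊔ g (latSub c (a ⊓ c)) :=
        Finset.inf_le (f := fun a => f a ⊔ g (latSub c a)) (by simp)
    _ ≤ f a ⊔ g b := sup_le_sup (hf inf_le_left) (hg hsub)

theorem infSub_mono (hf : Monotone f) (hg : Monotone g) : Monotone (infSub f g) :=
  fun _ d hcd => Finset.le_inf fun a _ =>
    infSub_le_sup hf hg (hcd.trans (le_sup_latSub d a))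

theorem infSub_le_left (hf : IsJoinEndo f) (hg : IsJoinEndo g) (c : L) :
    infSub f g c ≤ f c := by
  simpa [hg.1] using infSub_le_sup hf.monotone hg.monotone (le_sup_left : c ≤ c ⊔ ⊥)

theorem infSub_le_right (hf : IsJoinEndo f) (hg : IsJoinEndo g) (c : L) :
    infSub f g c ≤ g c := by
  simpa [hf.1] using infSub_le_sup hf.monotone hg.monotone (le_sup_right : c ≤ ⊥ ⊔ c)

theorem IsJoinEndo.infSub (hf : IsJoinEndo f) (hg : IsJoinEndo g) :
    IsJoinEndo (infSub f g) := by
  have hmono := infSub_mono hf.monotone hg.monotone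
  refine ⟨le_bot_iff.1 ((infSub_le_left hf hg ⊥).trans hf.1.le), fun c d => le_antisymm ?_
    (sup_le (hmono le_sup_left) (hmono le_sup_right))⟩
  conv_rhs => rw [_root_.infSub, _root_.infSub, Finset.inf_sup_inf]
  refine Finset.le_inf fun p _ => ?_
  rw [sup_sup_sup_comm, ← hf.2, ← hg.2]
  refine infSub_le_sup hf.monotone hg.monotone ?_
  rw [sup_sup_sup_comm]
  exact sup_le_sup (le_sup_latSub c p.1) (le_sup_latSub d p.2)

end infSub

theorem stmt_1 {L : Type*} [DistribLattice L] [BoundedOrder L] [Fintype L]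
    (f g h : L → L) (hf : IsJoinEndo f) (hg : IsJoinEndo g) (hh : IsJoinEndo h)
    (hhf : ∀ a, h a ≤ f a) (hhg : ∀ a, h a ≤ g a)
    (hmax : ∀ k : L → L, IsJoinEndo k → (∀ a, k a ≤ f a) → (∀ a, k a ≤ g a) →
      ∀ a, k a ≤ h a) :
    ∀ c : L,
      h c = (Finset.univ.filter (fun a : L => a ≤ c)).inf
        (fun a => f a ⊔ g (latSub c a)) := by
  intro c
  refine le_antisymm (Finset.le_inf fun a _ => ?_)
    (hmax _ (hf.infSub hg) (infSub_le_left hf hg) (infSub_le_right hf hg) c)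
  calc h c ≤ h (a ⊔ latSub c a) := hh.monotone (le_sup_latSub c a)
    _ = h a ⊔ h (latSub c a) := hh.2 _ _
    _ ≤ f a ⊔ g (latSub c a) := sup_le_sup (hhf _) (hhg _)
end

section
/- Let L be a finite lattice and let f : L → L be an arbitrary function. Then there exists a greatest join-endomorphism h of L with h ≤ f pointwise; that is, h is a join-endomorphism, h(a) ≤ f(a) for all a ∈ L, and every join-endomorphism g with g(a) ≤ f(a) for all a satisfies g(a) ≤ h(a) for all a. -/
theorem stmt_5 {L : Type*} [Lattice L] [OrderBot L] [Fintype L] (f : L → L) :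
    ∃ h : L → L, IsJoinEndo h ∧ (∀ a, h a ≤ f a) ∧
      ∀ g : L → L, IsJoinEndo g → (∀ a, g a ≤ f a) → ∀ a, g a ≤ h a := by
  classical
  let S : Finset (L → L) := {g | IsJoinEndo g ∧ ∀ a, g a ≤ f a}
  have hS : ∀ g ∈ S, IsJoinEndo g ∧ ∀ a, g a ≤ f a := fun g hg => by simpa [S] using hg
  refine ⟨fun a => S.sup fun g => g a, ⟨?_, fun a b => ?_⟩, fun a => ?_, fun g hg hgf a => ?_⟩
  · exact (Finset.sup_congr rfl fun g hg => (hS g hg).1.1).trans (Finset.sup_bot S)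
  · exact (Finset.sup_congr rfl fun g hg => (hS g hg).1.2 a b).trans Finset.sup_sup
  · exact Finset.sup_le fun g hg => (hS g hg).2 a
  · exact Finset.le_sup (f := fun g : L → L => g a) (by simpa [S] using ⟨hg, hgf⟩)
end

section
/- Let L be a finite lattice, J(L) its set of join-irreducible elements, and let g : J(L) → L be monotone. Let x₀ ∈ J(L) and y₀ ∈ L be such that y₀ is covered by g(x₀) and g(x) ≤ y₀ for all x ∈ J(L) with x < x₀. Define h : J(L) → L by h(x₀) = y₀ and h(x) = g(x) for x ≠ x₀. Then h is monotone and g covers h in the pointwise order on monotone functions J(L) → L (i.e., h < g and there is no monotone function strictly between them). -/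
theorem stmt_7 {L : Type*} [Lattice L] [OrderBot L] [Fintype L] [DecidableEq L]
    (g : {a : L // SupIrred a} → L) (hg : Monotone g)
    (x₀ : {a : L // SupIrred a}) (y₀ : L)
    (hcov : y₀ ⋖ g x₀)
    (hbelow : ∀ x : {a : L // SupIrred a}, x < x₀ → g x ≤ y₀) :
    Monotone (Function.update g x₀ y₀) ∧
      Function.update g x₀ y₀ < g ∧
      ¬ ∃ ℓ : {a : L // SupIrred a} → L,
          Monotone ℓ ∧ Function.update g x₀ y₀ < ℓ ∧ ℓ < g := by
  have hlt : Function.update g x₀ y₀ < g := update_lt_self_iff.2 hcov.lt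
  refine ⟨fun a b hab => ?_, hlt, ?_⟩
  · by_cases hb : b = x₀
    · subst hb
      rcases hab.eq_or_lt with rfl | h
      · exact le_rfl
      · simpa [h.ne] using hbelow a h
    · rw [Function.update_of_ne hb]
      exact (hlt.le a).trans (hg hab)
  · rintro ⟨ℓ, -, hℓ, hℓg⟩
    have hne : ∀ x, x ≠ x₀ → ℓ x = g x := fun x hx =>
      (hℓg.le x).antisymm (by simpa [hx] using hℓ.le x)
    have hy : y₀ ≤ ℓ x₀ := by simpa using hℓ.le x₀
    rcases hcov.eq_or_eq hy (hℓg.le x₀) with h | h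
    · exact hℓ.ne (Function.update_eq_iff.2 ⟨h.symm, fun x hx => (hne x hx).symm⟩)
    · refine hℓg.ne (funext fun x => ?_)
      by_cases hx : x = x₀
      · rw [hx, h]
      · exact hne x hx
end

section
/- Let L be a finite distributive lattice and let f be a join-endomorphism of L. Then f is join-irreducible among the join-endomorphisms of L (that is, f is not the constant ⊥ function, and whenever f is the pointwise join of two join-endomorphisms g and h, then f = g or f = h) if and only if there exist join-irreducible elements a, b of L such that f = f_{a,b}, where f_{a,b}(x) = b if x ≥ a and f_{a,b}(x) = ⊥ otherwise. -/
open scoped Classical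

namespace IsJoinEndo

section Lattice

variable {L : Type*} [Lattice L] [OrderBot L] {f : L → L}

theorem monotone_s8 (hf : IsJoinEndo f) : Monotone f := fun x y hxy => by
  have h := hf.2 x y
  rw [sup_eq_right.2 hxy] at h
  exact h ▸ le_sup_left

theorem map_finset_sup (hf : IsJoinEndo f) (s : Finset L) : f (s.sup id) = s.sup f :=
  Finset.apply_sup_eq_sup_comp f hf.2 hf.1

theorem finset_sup {ι : Type*} (s : Finset ι) {F : ι → L → L}
    (hF : ∀ i ∈ s, IsJoinEndo (F i)) : IsJoinEndo (s.sup F) := by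
  refine ⟨?_, fun x y => ?_⟩
  · rw [Finset.sup_apply]
    exact (Finset.sup_eq_bot_iff _ _).2 fun i hi => (hF i hi).1
  · simp only [Finset.sup_apply]
    rw [← Finset.sup_sup]
    exact Finset.sup_congr rfl fun i hi => (hF i hi).2 x y

/-- A join-irreducible join-endomorphism that is a finite join of join-endomorphisms is one of
them. -/
theorem exists_eq_of_eq_finset_sup {ι : Type*} (hbot : f ≠ ⊥)
    (hirr : ∀ g h : L → L, IsJoinEndo g → IsJoinEndo h → f = g ⊔ h → f = g ∨ f = h)
    (s : Finset ι) {F : ι → L → L} (hF : ∀ i ∈ s, IsJoinEndo (F i)) (hs : f = s.sup F) :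
    ∃ i ∈ s, f = F i := by
  induction s using Finset.induction_on with
  | empty => exact absurd hs hbot
  | insert i s _ ih =>
    have hFs : ∀ j ∈ s, IsJoinEndo (F j) := fun j hj => hF j (Finset.mem_insert_of_mem hj)
    rw [Finset.sup_insert] at hs
    rcases hirr _ _ (hF i (Finset.mem_insert_self i s)) (finset_sup s hFs) hs with h | h
    · exact ⟨i, Finset.mem_insert_self i s, h⟩
    · obtain ⟨j, hj, hfj⟩ := ih hFs h
      exact ⟨j, Finset.mem_insert_of_mem hj, hfj⟩

end Lattice

variable {L : Type*} [DistribLattice L] [OrderBot L] {f : L → L}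

theorem ite_le {a : L} (ha : SupIrred a) (b : L) :
    IsJoinEndo (fun x => if a ≤ x then b else ⊥) := by
  refine ⟨if_neg fun h => ha.ne_bot (le_bot_iff.1 h), fun x y => ?_⟩
  have h : a ≤ x ⊔ y ↔ a ≤ x ∨ a ≤ y := ha.supPrime.le_sup
  by_cases hx : a ≤ x <;> by_cases hy : a ≤ y <;> simp [h, hx, hy]

/-- A join-endomorphism of a finite distributive lattice is the join of the functions `f_{a,b}`
below it with `a` and `b` join-irreducible. -/
theorem eq_finset_sup_ite_le [Fintype L] (hf : IsJoinEndo f) :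
    f = (Finset.univ.filter fun p : L × L => SupIrred p.1 ∧ SupIrred p.2 ∧ p.2 ≤ f p.1).sup
      (fun p x => if p.1 ≤ x then p.2 else ⊥) := by
  funext x
  rw [Finset.sup_apply]
  apply le_antisymm
  · obtain ⟨s, rfl, hs⟩ := exists_supIrred_decomposition x
    rw [hf.map_finset_sup]
    refine Finset.sup_le fun a ha => ?_
    obtain ⟨t, hta, ht⟩ := exists_supIrred_decomposition (f a)
    rw [← hta]
    refine Finset.sup_le fun b hb => ?_
    have hbf : b ≤ f a := hta ▸ Finset.le_sup (f := id) hb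
    refine Finset.le_sup_of_le (b := (a, b)) (by simp [hs ha, ht hb, hbf]) ?_
    exact (if_pos (Finset.le_sup (f := id) ha)).ge
  · refine Finset.sup_le fun p hp => ?_
    split_ifs with h
    · exact (Finset.mem_filter.1 hp).2.2.2.trans (hf.monotone_s8 h)
    · exact bot_le

end IsJoinEndo

theorem ite_le_eq_of_apply_eq {L : Type*} [Lattice L] [OrderBot L] {a b : L} {g : L → L}
    (hg : IsJoinEndo g) (hle : ∀ x, g x ≤ if a ≤ x then b else ⊥) (hga : g a = b) :
    (fun x => if a ≤ x then b else ⊥) = g := by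
  funext x
  refine le_antisymm ?_ (hle x)
  split_ifs with h
  · exact hga ▸ hg.monotone_s8 h
  · exact bot_le

theorem stmt_8 {L : Type*} [DistribLattice L] [OrderBot L] [Fintype L]
    (f : L → L) (hf : IsJoinEndo f) :
    (f ≠ (fun _ => ⊥) ∧
        ∀ g h : L → L, IsJoinEndo g → IsJoinEndo h →
          f = (fun x => g x ⊔ h x) → f = g ∨ f = h) ↔
      ∃ a b : L, SupIrred a ∧ SupIrred b ∧
        f = (fun x => if a ≤ x then b else ⊥) := by
  constructor
  · rintro ⟨hbot, hirr⟩
    obtain ⟨⟨a, b⟩, hp, hfp⟩ := IsJoinEndo.exists_eq_of_eq_finset_sup hbot hirr _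
      (fun p hp => IsJoinEndo.ite_le (Finset.mem_filter.1 hp).2.1 p.2) hf.eq_finset_sup_ite_le
    have hab := (Finset.mem_filter.1 hp).2
    exact ⟨a, b, hab.1, hab.2.1, hfp⟩
  · rintro ⟨a, b, -, hb, rfl⟩
    refine ⟨fun h => hb.ne_bot (by simpa using congrFun h a), fun g h hg hh hgh => ?_⟩
    have hsup : g a ⊔ h a = b := by simpa using (congrFun hgh a).symm
    refine (hb.2 hsup).imp (ite_le_eq_of_apply_eq hg fun x => ?_)
      (ite_le_eq_of_apply_eq hh fun x => ?_)
    · exact le_sup_left.trans (congrFun hgh x).ge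
    · exact le_sup_right.trans (congrFun hgh x).ge
end

section
/- Let L be a finite distributive lattice and let f be a join-endomorphism of L. Then for every c ∈ L, f(c) = ⨆ { a : a is join-irreducible in L and there exists a join-irreducible b in L with a ≤ f(b) and b ≤ c }. -/
open scoped Classical

theorem stmt_9 {L : Type*} [DistribLattice L] [OrderBot L] [Fintype L]
    (f : L → L) (hf : IsJoinEndo f) :
    ∀ c : L,
      f c = (Finset.univ.filter
          (fun a : L => SupIrred a ∧ ∃ b : L, SupIrred b ∧ a ≤ f b ∧ b ≤ c)).sup
        id := by
  intro c
  have monotone_f : Monotone f := fun a b hab => by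
    rw [← sup_eq_right.mpr hab, hf.2]
    exact le_sup_left
  apply le_antisymm
  · obtain ⟨s, hs, hs_irred⟩ := exists_supIrred_decomposition c
    have map_c : f c = s.sup f := by
      rw [← hs]
      exact Finset.apply_sup_eq_sup_comp f hf.2 hf.1
    rw [map_c]
    refine Finset.sup_le fun b hb => ?_
    obtain ⟨t, ht, ht_irred⟩ := exists_supIrred_decomposition (f b)
    conv_lhs => rw [← ht]
    refine Finset.sup_mono fun a ha => ?_
    rw [Finset.mem_filter]
    exact ⟨Finset.mem_univ a, ht_irred ha, b, hs_irred hb,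
      ht ▸ Finset.le_sup (f := id) ha, hs ▸ Finset.le_sup (f := id) hb⟩
  · refine Finset.sup_le fun a ha => ?_
    obtain ⟨-, -, b, -, hab, hbc⟩ := Finset.mem_filter.mp ha
    exact hab.trans (monotone_f hbc)
end

section
/- Let Ω be a finite set and let S ⊆ P(Ω) be a collection of subsets with Ω ∈ S that is closed under binary unions and binary intersections. Let f : S → S satisfy f(Ω) = Ω and f(E ∩ F) = f(E) ∩ f(F) for all E, F ∈ S. Define the relation R ⊆ Ω × Ω by (σ, τ) ∈ R iff for every E ∈ S, σ ∈ f(E) implies τ ∈ E. Then for every E ∈ S, { ω ∈ Ω : R(ω) ⊆ E } = f(E). -/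
/-- The knowledge operator of an accessibility relation `R ⊆ Ω × Ω`:
`K_R(E) = { ω | R(ω) ⊆ E }`. -/
def KOp {Ω : Type*} (R : Set (Ω × Ω)) (E : Set Ω) : Set Ω :=
  {ω | {ω' | (ω, ω') ∈ R} ⊆ E}

theorem stmt_12 {Ω : Type*} [Fintype Ω] (S : Set (Set Ω))
    (hΩ : Set.univ ∈ S)
    (hunion : ∀ E ∈ S, ∀ F ∈ S, E ∪ F ∈ S)
    (hinter : ∀ E ∈ S, ∀ F ∈ S, E ∩ F ∈ S)
    (f : Set Ω → Set Ω)
    (hfS : ∀ E ∈ S, f E ∈ S)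
    (hftop : f Set.univ = Set.univ)
    (hfinter : ∀ E ∈ S, ∀ F ∈ S, f (E ∩ F) = f E ∩ f F) :
    ∀ E ∈ S, KOp {p : Ω × Ω | ∀ E ∈ S, p.1 ∈ f E → p.2 ∈ E} E = f E := by
  intro E hE
  ext ω
  refine ⟨fun hω => ?_, fun hω τ hτ => hτ E hE hω⟩
  have hT : FiniteInter {F | F ∈ S ∧ ω ∈ f F} :=
    { univ_mem := ⟨hΩ, hftop.ge (Set.mem_univ ω)⟩
      inter_mem := fun F hF G hG =>
        ⟨hinter F hF.1 G hG.1, (hfinter F hF.1 G hG.1).ge ⟨hF.2, hG.2⟩⟩ }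
  have hfin := Set.toFinite {F | F ∈ S ∧ ω ∈ f F}
  have hmem := hT.finiteInter_mem hfin.toFinset (by simp)
  rw [hfin.coe_toFinset] at hmem
  have hsub : ⋂₀ {F | F ∈ S ∧ ω ∈ f F} ⊆ E := fun τ hτ =>
    hω fun F hF hωF => hτ F ⟨hF, hωF⟩
  have hf := hfinter _ hmem.1 E hE
  rw [Set.inter_eq_left.mpr hsub] at hf
  exact (hf.le hmem.2).2
end

section
/- Let Ω be a finite set and let f : P(Ω) → P(Ω) satisfy f(Ω) = Ω and f(E ∩ F) = f(E) ∩ f(F) for all E, F ⊆ Ω. Define the relation R ⊆ Ω × Ω by (σ, τ) ∈ R iff σ ∉ f(Ω \ {τ}). Then for every E ⊆ Ω, { ω ∈ Ω : R(ω) ⊆ E } = f(E). -/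
/-- A map on sets preserving the universe and binary intersections is determined on complements of
finite sets by its values on complements of singletons. -/
theorem mem_map_compl_iff_of_finite {α β : Type*} {f : Set α → Set β}
    (hftop : f Set.univ = Set.univ) (hfinter : ∀ E F : Set α, f (E ∩ F) = f E ∩ f F)
    {S : Set α} (hS : S.Finite) (b : β) : b ∈ f Sᶜ ↔ ∀ a ∈ S, b ∈ f {a}ᶜ := by
  induction S, hS using Set.Finite.induction_on with
  | empty => simp [hftop]
  | @insert a S _ _ ih =>
    rw [Set.insert_eq, Set.compl_union, hfinter, Set.mem_inter_iff, ih]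
    simp

theorem stmt_13 {Ω : Type*} [Fintype Ω] (f : Set Ω → Set Ω)
    (hftop : f Set.univ = Set.univ)
    (hfinter : ∀ E F : Set Ω, f (E ∩ F) = f E ∩ f F) :
    ∀ E : Set Ω, KOp {p : Ω × Ω | p.1 ∉ f ({p.2}ᶜ)} E = f E := by
  intro E
  ext ω
  rw [← compl_compl E, mem_map_compl_iff_of_finite hftop hfinter (Set.toFinite Eᶜ), compl_compl]
  exact forall_congr' fun _ => not_imp_comm
end

section
/- Let Ω be a finite set, let R_i, R_j ⊆ Ω × Ω be binary relations with knowledge operators K_i and K_j, and define the distributed knowledge operator D : P(Ω) → P(Ω) by D(E) = { ω ∈ Ω : R_i(ω) ∩ R_j(ω) ⊆ E }. Then D is the greatest lower bound of K_i and K_j in the lattice of join-endomorphisms of (P(Ω), ⊇); explicitly: D(Ω) = Ω and D(E ∩ F) = D(E) ∩ D(F) for all E, F ⊆ Ω; K_i(E) ⊆ D(E) and K_j(E) ⊆ D(E) for all E ⊆ Ω; and for every function h : P(Ω) → P(Ω) with h(Ω) = Ω, h(E ∩ F) = h(E) ∩ h(F) for all E, F, and K_i(E) ⊆ h(E) and K_j(E)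 ⊆ h(E) for all E, one has D(E) ⊆ h(E) for all E ⊆ Ω. -/
/-- The distributed knowledge operator of two accessibility relations:
`D(E) = { ω | R_i(ω) ∩ R_j(ω) ⊆ E }`. -/
def DKOp {Ω : Type*} (Ri Rj : Set (Ω × Ω)) (E : Set Ω) : Set Ω :=
  {ω | {ω' | (ω, ω') ∈ Ri} ∩ {ω' | (ω, ω') ∈ Rj} ⊆ E}

theorem stmt_15 {Ω : Type*} [Fintype Ω] (Ri Rj : Set (Ω × Ω)) :
    (DKOp Ri Rj Set.univ = Set.univ ∧
        ∀ E F : Set Ω, DKOp Ri Rj (E ∩ F) = DKOp Ri Rj E ∩ DKOp Ri Rj F) ∧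
      (∀ E : Set Ω, KOp Ri E ⊆ DKOp Ri Rj E) ∧
      (∀ E : Set Ω, KOp Rj E ⊆ DKOp Ri Rj E) ∧
      ∀ h : Set Ω → Set Ω,
        h Set.univ = Set.univ →
        (∀ E F : Set Ω, h (E ∩ F) = h E ∩ h F) →
        (∀ E : Set Ω, KOp Ri E ⊆ h E) →
        (∀ E : Set Ω, KOp Rj E ⊆ h E) →
        ∀ E : Set Ω, DKOp Ri Rj E ⊆ h E := by
  refine ⟨⟨Set.eq_univ_of_forall fun _ => Set.subset_univ _,
    fun E F => Set.ext fun _ => Set.subset_inter_iff⟩,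
    fun E _ hω => Set.inter_subset_left.trans hω,
    fun E _ hω => Set.inter_subset_right.trans hω, ?_⟩
  intro h _ h_inter hi hj E ω hω
  have hE : (E ∪ {ω' | (ω, ω') ∈ Ri}) ∩ (E ∪ {ω' | (ω, ω') ∈ Rj}) = E := by
    rw [← Set.union_inter_distrib_left]
    exact Set.union_eq_self_of_subset_right hω
  rw [← hE, h_inter]
  exact ⟨hi _ Set.subset_union_right, hj _ Set.subset_union_right⟩
end

section
/- Let Ω be a finite set and let R_i, R_j, R_m ⊆ Ω × Ω be binary relations with knowledge operators K_i, K_j, K_m, and let D(E) = { ω ∈ Ω : R_i(ω) ∩ R_j(ω) ⊆ E } be the distributed knowledge operator of R_i and R_j. Then K_m = D (as functions on subsets of Ω) if and only if for every ω ∈ Ω, K_m(Ω \ {ω}) = K_i(Ω \ {ω}) ∪ K_j(Ω \ {ω}). -/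
theorem mem_KOp_compl_singleton {Ω : Type*} {R : Set (Ω × Ω)} {a b : Ω} :
    a ∈ KOp R {b}ᶜ ↔ (a, b) ∉ R :=
  Set.subset_compl_singleton_iff

theorem DKOp_eq_KOp_inter {Ω : Type*} (Ri Rj : Set (Ω × Ω)) :
    DKOp Ri Rj = KOp (Ri ∩ Rj) :=
  rfl

theorem KOp_injective {Ω : Type*} :
    Function.Injective (KOp : Set (Ω × Ω) → Set Ω → Set Ω) := by
  intro R S h
  ext ⟨a, b⟩
  rw [← not_iff_not, ← mem_KOp_compl_singleton, ← mem_KOp_compl_singleton, h]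

theorem stmt_16 {Ω : Type*} [Fintype Ω] (Ri Rj Rm : Set (Ω × Ω)) :
    KOp Rm = DKOp Ri Rj ↔
      ∀ ω : Ω, KOp Rm ({ω}ᶜ) = KOp Ri ({ω}ᶜ) ∪ KOp Rj ({ω}ᶜ) := by
  rw [DKOp_eq_KOp_inter, KOp_injective.eq_iff]
  simp only [Set.ext_iff, Prod.forall, Set.mem_union, mem_KOp_compl_singleton, Set.mem_inter_iff,
    ← not_and_or, not_iff_not]
  exact forall_comm
end
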